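/- Let D and D' be unconditionally equivalent DAGs on the same finite vertex set V. Then there exists a finite sequence of DAGs D = D_0, D_1, …, D_N = D', each unconditionally equivalent to D, consisting of three consecutive phases: first k edge insertions, where k is the number of unordered vertex pairs adjacent in D' but not in D, and each inserted edge v → w is such that (v, w) is partially weakly covered or implied by transitivity in the DAG before the insertion; then some number of edge reversals, each reversing an edge that is weakly covered in the DAG before the reversal; and finally ℓ edge deletions, where ℓ is the number of unordered vertex pairs adjacent in D but not in D', and each deleted edge v → w is such that (v, w) is partially weakly covered or implied by transitivity in the DAG after the deletion. -/

import Mathlib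

namespace UEC

variable {V : Type*}

/-- A directed graph is a DAG if it has no directed cycles. -/
def IsDAG (D : Digraph V) : Prop := ∀ v : V, ¬ Relation.TransGen D.Adj v v

/-- `an D v` : the set of ancestors of `v` (nodes with a directed path to `v`),
including `v` itself. -/
def an (D : Digraph V) (v : V) : Set V := {u | Relation.ReflTransGen D.Adj u v}

/-- `de D v` : the set of descendants of `v` (nodes reachable by a directed path
from `v`), including `v` itself. -/
def de (D : Digraph V) (v : V) : Set V := {u | Relation.ReflTransGen D.Adj v u}

/-- `pa D v` : the set of parents of `v`. -/
def pa (D : Digraph V) (v : V) : Set V := {u | D.Adj u v}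

/-- A source node is a node with no parents. -/
def IsSource (D : Digraph V) (v : V) : Prop := pa D v = ∅

/-- `sources D` : the set of source nodes of `D` (denoted `ma_D(V)` in the paper). -/
def sources (D : Digraph V) : Set V := {v | IsSource D v}

/-- Ancestors of a set of nodes. -/
def anSet (D : Digraph V) (A : Set V) : Set V := ⋃ a ∈ A, an D a

/-- `maSet D A = {u ∈ an_D(A) : an_D(u) = {u}}`, the source nodes that are
ancestors of `A`. -/
def maSet (D : Digraph V) (A : Set V) : Set V :=
  {u | u ∈ anSet D A ∧ an D u = {u}}

/-- Two nodes are adjacent in a digraph if there is an edge between them in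
either direction. -/
def Adjacent (D : Digraph V) (v w : V) : Prop := D.Adj v w ∨ D.Adj w v

/-- A trek in `D` is a path over distinct vertices (given as the list of its
vertices, consecutive ones being adjacent) containing no collider
`p i → p (i+1) ← p (i+2)` as a subpath. -/
def IsTrekList (D : Digraph V) (p : List V) : Prop :=
  p.Nodup ∧
    (∀ i : ℕ, (h : i + 1 < p.length) →
      (D.Adj (p.get ⟨i, by omega⟩) (p.get ⟨i + 1, h⟩) ∨
        D.Adj (p.get ⟨i + 1, h⟩) (p.get ⟨i, by omega⟩))) ∧
    (∀ i : ℕ, (h : i + 2 < p.length) →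
      ¬(D.Adj (p.get ⟨i, by omega⟩) (p.get ⟨i + 1, by omega⟩) ∧
        D.Adj (p.get ⟨i + 2, h⟩) (p.get ⟨i + 1, by omega⟩)))

/-- There is a trek between `v` and `w` in `D`. -/
def HasTrek (D : Digraph V) (v w : V) : Prop :=
  ∃ p : List V, IsTrekList D p ∧ p.head? = some v ∧ p.getLast? = some w

/-- Adjacency in the unconditional dependence graph `U^D` : two distinct nodes
are adjacent iff there is a trek between them. -/
def UAdj (D : Digraph V) (v w : V) : Prop :=
  v ≠ w ∧ (HasTrek D v w ∨ HasTrek D w v)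

/-- Two digraphs on the same vertex set are unconditionally equivalent if for
all distinct nodes there is a trek between them in one iff there is one in the
other. -/
def UncondEquiv (D D' : Digraph V) : Prop :=
  ∀ v w : V, v ≠ w → (HasTrek D v w ↔ HasTrek D' v w)

/-- The digraph obtained by adding the edge `v → w`. -/
def addEdge (D : Digraph V) (v w : V) : Digraph V :=
  ⟨fun a b => D.Adj a b ∨ (a = v ∧ b = w)⟩

/-- The digraph obtained by deleting the edge `v → w`. -/
def delEdge (D : Digraph V) (v w : V) : Digraph V :=
  ⟨fun a b => D.Adj a b ∧ ¬(a = v ∧ b = w)⟩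

/-- The digraph obtained by replacing the edge `v → w` with `w → v`. -/
def revEdge (D : Digraph V) (v w : V) : Digraph V :=
  ⟨fun a b => (D.Adj a b ∧ ¬(a = v ∧ b = w)) ∨ (a = w ∧ b = v)⟩

/-- The ordered pair `(v, w)` is partially weakly covered in `D`. -/
def PartiallyWeaklyCovered (D : Digraph V) (v w : V) : Prop :=
  maSet D {v} ⊆ maSet D {w} ∧ v ∉ an D w ∧ w ∉ an D v ∧ pa D v ≠ ∅

/-- The ordered pair `(v, w)` is implied by transitivity in `D`, i.e.
`v ∈ an_D(w) \ ({w} ∪ pa_D(w))`. -/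
def ImpliedByTransitivity (D : Digraph V) (v w : V) : Prop :=
  v ∈ an D w \ ({w} ∪ pa D w)

/-- The edge `v → w` is weakly covered in `D`. -/
def WeaklyCovered (D : Digraph V) (v w : V) : Prop :=
  maSet D (pa D v) = maSet D (pa D w \ {v}) ∧ v ∉ anSet D (pa D w \ {v})

/-- One edge insertion: `D2` is obtained from `D1` by adding an edge `v → w`
between nonadjacent nodes such that `(v, w)` is partially weakly covered or
implied by transitivity in `D1`. -/
def InsertStep (D1 D2 : Digraph V) : Prop :=
  ∃ v w : V, v ≠ w ∧ ¬ Adjacent D1 v w ∧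
    (PartiallyWeaklyCovered D1 v w ∨ ImpliedByTransitivity D1 v w) ∧
    D2 = addEdge D1 v w

/-- One edge reversal: `D2` is obtained from `D1` by reversing an edge
`v → w` that is weakly covered in `D1`. -/
def ReverseStep (D1 D2 : Digraph V) : Prop :=
  ∃ v w : V, D1.Adj v w ∧ WeaklyCovered D1 v w ∧ D2 = revEdge D1 v w

/-- One edge deletion: `D2` is obtained from `D1` by deleting an edge `v → w`
such that `(v, w)` is partially weakly covered or implied by transitivity in
the resulting graph `D2`. -/
def DeleteStep (D1 D2 : Digraph V) : Prop :=
  ∃ v w : V, D1.Adj v w ∧ D2 = delEdge D1 v w ∧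
    (PartiallyWeaklyCovered D2 v w ∨ ImpliedByTransitivity D2 v w)

open Relation

section Treks

variable {D : Digraph V}

theorem IsDAG.asymm (hD : IsDAG D) {a b : V} (h : D.Adj a b) : ¬ D.Adj b a := fun h' =>
  hD a ((TransGen.single h).tail h')

theorem HasTrek.refl (w : V) : HasTrek D w w :=
  ⟨[w], ⟨by simp, by simp, by simp⟩, by simp, by simp⟩

theorem IsTrekList.tail {a : V} {l : List V} (h : IsTrekList D (a :: l)) : IsTrekList D l := by
  obtain ⟨h1, h2, h3⟩ := h
  refine ⟨(List.nodup_cons.1 h1).2, fun i hi => ?_, fun i hi => ?_⟩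
  · simpa using h2 (i + 1) (by simpa using hi)
  · simpa using h3 (i + 1) (by simp; omega)

theorem IsTrekList.suffix {l₁ l₂ : List V} (h : IsTrekList D (l₁ ++ l₂)) : IsTrekList D l₂ := by
  induction l₁ with
  | nil => exact h
  | cons a l₁ ih => exact ih h.tail

theorem HasTrek.of_adj (hD : IsDAG D) {a b w : V} (hba : D.Adj b a) (h : HasTrek D b w) :
    HasTrek D a w := by
  obtain ⟨p, hp, hb, hw⟩ := h
  by_cases hap : a ∈ p
  · obtain ⟨s, t, rfl⟩ := List.append_of_mem hap
    refine ⟨a :: t, hp.suffix, by simp, ?_⟩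
    rw [← hw, List.getLast?_append]
    simp [List.getLast?_cons]
  · obtain _ | ⟨c, l⟩ := p
    · simp at hb
    obtain rfl : c = b := by simpa using hb
    refine ⟨a :: c :: l, ⟨List.nodup_cons.2 ⟨hap, hp.1⟩, ?_, ?_⟩, by simp, by simpa using hw⟩
    · rintro (_ | i) hi
      · exact Or.inr hba
      · simpa using hp.2.1 i (by simpa using hi)
    · rintro (_ | i) hi
      · exact fun h => hD.asymm h.1 hba
      · simpa using hp.2.2 i (by simp at hi ⊢; omega)

theorem HasTrek.of_reflTransGen (hD : IsDAG D) {u w : V} (h : ReflTransGen D.Adj u w) :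
    HasTrek D u w := by
  obtain ⟨l, hl, hw⟩ := List.exists_isChain_cons_of_relationReflTransGen h
  have hget := List.isChain_iff_getElem.1 hl
  refine ⟨u :: l, ⟨?_, fun i hi => Or.inl (hget i hi), fun i hi hc => ?_⟩, by simp, ?_⟩
  · have := List.isChain_iff_pairwise.1 (hl.imp fun a b (hab : D.Adj a b) => TransGen.single hab)
    refine this.imp ?_
    rintro a b hab rfl
    exact hD a hab
  · exact hD.asymm (hget (i + 1) hi) hc.2
  · rw [List.getLast?_eq_getLast_of_ne_nil (by simp), hw]

/-- `v` and `w` have a common ancestor. -/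
def Confounded (D : Digraph V) (v w : V) : Prop :=
  ∃ u, ReflTransGen D.Adj u v ∧ ReflTransGen D.Adj u w

theorem IsTrekList.reflTransGen {l : List V} :
    ∀ {a b w : V}, IsTrekList D (a :: b :: l) → D.Adj a b → (a :: b :: l).getLast? = some w →
      ReflTransGen D.Adj a w := by
  induction l with
  | nil =>
    intro a b w _ hab hw
    obtain rfl : b = w := by simpa using hw
    exact .single hab
  | cons c l ih =>
    intro a b w h hab hw
    have hbc : D.Adj b c := by
      rcases h.2.1 1 (by simp) with h1 | h1
      · exact h1
      · exact (h.2.2 0 (by simp) ⟨hab, h1⟩).elim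
    exact .head hab (ih h.tail hbc (by simpa using hw))

theorem IsTrekList.confounded {l : List V} :
    ∀ {a w : V}, IsTrekList D (a :: l) → (a :: l).getLast? = some w → Confounded D a w := by
  induction l with
  | nil =>
    intro a w _ hw
    obtain rfl : a = w := by simpa using hw
    exact ⟨a, .refl, .refl⟩
  | cons b l ih =>
    intro a w h hw
    rcases h.2.1 0 (by simp) with h1 | h1
    · exact ⟨a, .refl, h.reflTransGen h1 hw⟩
    · obtain ⟨u, hu, hu'⟩ := ih h.tail (by simpa using hw)
      exact ⟨u, hu.tail h1, hu'⟩

theorem hasTrek_iff_confounded (hD : IsDAG D) {v w : V} : HasTrek D v w ↔ Confounded D v w := by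
  constructor
  · rintro ⟨_ | ⟨a, l⟩, hp, hv, hw⟩
    · simp at hv
    · obtain rfl : a = v := by simpa using hv
      exact hp.confounded hw
  · rintro ⟨u, hv, hw⟩
    induction hv with
    | refl => exact .of_reflTransGen hD hw
    | tail _ h ih => exact ih.of_adj hD h

end Treks

section Labelings

variable {ι : Type*} {m : V → Set ι} {D E : Digraph V}

/-- `D` is a DAG whose unconditional dependences are those encoded by the labeling `m`: two nodes
are dependent if and only if their labels meet. The conditions are local in `D`. -/
structure IsCompatible (m : V → Set ι) (D : Digraph V) : Prop where
  isDAG : IsDAG D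
  mono : ∀ ⦃a b⦄, D.Adj a b → m a ⊆ m b
  cover : ∀ ⦃v⦄, ¬ IsSource D v → ∀ s ∈ m v, ∃ u, D.Adj u v ∧ s ∈ m u
  source : ∀ ⦃v⦄, IsSource D v → ∃ s, m v = {s}
  inj : ∀ ⦃v w⦄, IsSource D v → IsSource D w → m v = m w → v = w

theorem isSource_iff {v : V} : IsSource D v ↔ ∀ u, ¬ D.Adj u v := by
  simp [IsSource, pa, Set.eq_empty_iff_forall_notMem]

theorem exists_adj_of_not_isSource {v : V} (h : ¬ IsSource D v) : ∃ u, D.Adj u v := by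
  simpa [isSource_iff] using h

theorem IsSource.eq_of_reflTransGen {u v : V} (hv : IsSource D v) (h : ReflTransGen D.Adj u v) :
    u = v := by
  rcases h.cases_tail with h | ⟨c, _, hc⟩
  · exact h.symm
  · exact (isSource_iff.1 hv c hc).elim

theorem an_eq_singleton_iff (hD : IsDAG D) {v : V} : an D v = {v} ↔ IsSource D v := by
  refine ⟨fun h => isSource_iff.2 fun u hu => ?_, fun h => ?_⟩
  · have : u ∈ an D v := .single hu
    rw [h] at this
    obtain rfl : u = v := this
    exact hD u (.single hu)
  · ext u
    exact ⟨fun hu => h.eq_of_reflTransGen hu, by rintro rfl; exact .refl⟩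

theorem mem_maSet_iff (hD : IsDAG D) {A : Set V} {u : V} :
    u ∈ maSet D A ↔ IsSource D u ∧ ∃ a ∈ A, ReflTransGen D.Adj u a := by
  simp only [maSet, anSet, an, Set.mem_iUnion, Set.mem_ofPred_eq, exists_prop]
  rw [and_comm]
  exact and_congr_left' (an_eq_singleton_iff hD)

theorem IsDAG.wellFounded [Finite V] (hD : IsDAG D) : WellFounded (TransGen D.Adj) :=
  haveI : Std.Irrefl (TransGen D.Adj) := ⟨hD⟩
  Finite.wellFounded_of_trans_of_irrefl _

theorem IsDAG.wellFounded_swap [Finite V] (hD : IsDAG D) :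
    WellFounded (Function.swap (TransGen D.Adj)) :=
  haveI : Std.Irrefl (Function.swap (TransGen D.Adj)) := ⟨hD⟩
  haveI : IsTrans V (Function.swap (TransGen D.Adj)) := ⟨fun _ _ _ h h' => h'.trans h⟩
  Finite.wellFounded_of_trans_of_irrefl _

theorem exists_isSource_reflTransGen [Finite V] (hD : IsDAG D) (v : V) :
    ∃ u, IsSource D u ∧ ReflTransGen D.Adj u v := by
  induction v using hD.wellFounded.induction with
  | _ v ih =>
    by_cases hv : IsSource D v
    · exact ⟨v, hv, .refl⟩
    · obtain ⟨p, hp⟩ := exists_adj_of_not_isSource hv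
      obtain ⟨u, hu, hup⟩ := ih p (.single hp)
      exact ⟨u, hu, hup.tail hp⟩

namespace IsCompatible

theorem mono_reflTransGen (hD : IsCompatible m D) {a b : V} (h : ReflTransGen D.Adj a b) :
    m a ⊆ m b := by
  induction h with
  | refl => exact subset_rfl
  | tail _ h ih => exact ih.trans (hD.mono h)

theorem eq_singleton (hD : IsCompatible m D) {v : V} (hv : IsSource D v) {s : ι} (hs : s ∈ m v) :
    m v = {s} := by
  obtain ⟨t, ht⟩ := hD.source hv
  rw [ht] at hs ⊢
  rw [Set.mem_singleton_iff.1 hs]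

theorem source_unique (hD : IsCompatible m D) {v w : V} (hv : IsSource D v) (hw : IsSource D w)
    {s : ι} (hsv : s ∈ m v) (hsw : s ∈ m w) : v = w :=
  hD.inj hv hw ((hD.eq_singleton hv hsv).trans (hD.eq_singleton hw hsw).symm)

variable [Finite V]

theorem nonempty (hD : IsCompatible m D) (v : V) : (m v).Nonempty := by
  obtain ⟨u, hu, huv⟩ := exists_isSource_reflTransGen hD.isDAG v
  obtain ⟨s, hs⟩ := hD.source hu
  exact ⟨s, hD.mono_reflTransGen huv (by simp [hs])⟩

theorem exists_source (hD : IsCompatible m D) {v : V} {s : ι} (hs : s ∈ m v) :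
    ∃ u, IsSource D u ∧ s ∈ m u ∧ ReflTransGen D.Adj u v := by
  induction v using hD.isDAG.wellFounded.induction with
  | _ v ih =>
    by_cases hv : IsSource D v
    · exact ⟨v, hv, hs, .refl⟩
    · obtain ⟨p, hp, hsp⟩ := hD.cover hv s hs
      obtain ⟨u, hu, hsu, hup⟩ := ih p (.single hp) hsp
      exact ⟨u, hu, hsu, hup.tail hp⟩

theorem confounded_iff (hD : IsCompatible m D) {v w : V} :
    Confounded D v w ↔ (m v ∩ m w).Nonempty := by
  constructor
  · rintro ⟨u, hv, hw⟩
    obtain ⟨s, hs⟩ := hD.nonempty u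
    exact ⟨s, hD.mono_reflTransGen hv hs, hD.mono_reflTransGen hw hs⟩
  · rintro ⟨s, hsv, hsw⟩
    obtain ⟨u, hu, hsu, huv⟩ := hD.exists_source hsv
    obtain ⟨u', hu', hsu', huw⟩ := hD.exists_source hsw
    obtain rfl := hD.source_unique hu hu' hsu hsu'
    exact ⟨u, huv, huw⟩

theorem uncondEquiv (hD : IsCompatible m D) (hE : IsCompatible m E) : UncondEquiv D E :=
  fun v w _ => by
    rw [hasTrek_iff_confounded hD.isDAG, hasTrek_iff_confounded hE.isDAG, hD.confounded_iff,
      hE.confounded_iff]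

theorem maSet_subset (hD : IsCompatible m D) {A B : Set V}
    (h : ∀ s, ∀ a ∈ A, s ∈ m a → ∃ b ∈ B, s ∈ m b) : maSet D A ⊆ maSet D B := by
  intro u hu
  rw [mem_maSet_iff hD.isDAG] at hu ⊢
  obtain ⟨hu, a, ha, hua⟩ := hu
  obtain ⟨s, hs⟩ := hD.nonempty u
  obtain ⟨b, hb, hsb⟩ := h s a ha (hD.mono_reflTransGen hua hs)
  obtain ⟨r, hr, hsr, hrb⟩ := hD.exists_source hsb
  obtain rfl := hD.source_unique hu hr hs hsr
  exact ⟨hu, b, hb, hrb⟩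

end IsCompatible

theorem UncondEquiv.confounded_iff (h : UncondEquiv D E) (hD : IsDAG D) (hE : IsDAG E) (v w : V) :
    Confounded D v w ↔ Confounded E v w := by
  by_cases hvw : v = w
  · subst hvw
    exact ⟨fun _ => ⟨v, .refl, .refl⟩, fun _ => ⟨v, .refl, .refl⟩⟩
  · rw [← hasTrek_iff_confounded hD, ← hasTrek_iff_confounded hE]
    exact h v w hvw

/-- The labeling of the nodes by their ancestral sources. -/
def sourceLabel (D : Digraph V) (v : V) : Set V := {s | IsSource D s ∧ ReflTransGen D.Adj s v}

theorem mem_sourceLabel_iff {s v : V} :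
    s ∈ sourceLabel D v ↔ IsSource D s ∧ Confounded D s v := by
  refine and_congr_right fun hs => ⟨fun h => ⟨s, .refl, h⟩, ?_⟩
  rintro ⟨u, hus, huv⟩
  exact hs.eq_of_reflTransGen hus ▸ huv

theorem isCompatible_sourceLabel [Finite V] (hD : IsDAG D) (hE : IsDAG E)
    (h : ∀ v w, Confounded D v w ↔ Confounded E v w) : IsCompatible (sourceLabel D) E where
  isDAG := hE
  mono a b hab s hs := by
    rw [mem_sourceLabel_iff, h] at hs ⊢
    obtain ⟨hs, u, hus, hua⟩ := hs
    exact ⟨hs, u, hus, hua.tail hab⟩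
  cover v hv s hs := by
    rw [mem_sourceLabel_iff, h] at hs
    obtain ⟨hs, u, hus, huv⟩ := hs
    rcases huv.cases_tail with rfl | ⟨p, hup, hpv⟩
    · obtain ⟨p, hp⟩ := exists_adj_of_not_isSource hv
      exact ⟨p, hp, mem_sourceLabel_iff.2 ⟨hs, (h _ _).2 ⟨p, hus.head hp, .refl⟩⟩⟩
    · exact ⟨p, hpv, mem_sourceLabel_iff.2 ⟨hs, (h _ _).2 ⟨u, hus, hup⟩⟩⟩
  source v hv := by
    obtain ⟨s, hs, hsv⟩ := exists_isSource_reflTransGen hD v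
    refine ⟨s, Set.eq_singleton_iff_unique_mem.2 ⟨⟨hs, hsv⟩, fun t ht => ?_⟩⟩
    have key : ∀ {x}, x ∈ sourceLabel D v → ReflTransGen E.Adj v x := fun {x} hx => by
      rw [mem_sourceLabel_iff, h] at hx
      obtain ⟨_, u, hux, huv⟩ := hx
      exact hv.eq_of_reflTransGen huv ▸ hux
    obtain ⟨u, hut, hus⟩ := (h t s).2 ⟨v, key ht, key ⟨hs, hsv⟩⟩
    exact (ht.1.eq_of_reflTransGen hut).symm.trans (hs.eq_of_reflTransGen hus)
  inj v w hv hw hvw := by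
    obtain ⟨s, hs, hsv⟩ := exists_isSource_reflTransGen hD v
    have hsw : s ∈ sourceLabel D w := hvw ▸ (⟨hs, hsv⟩ : s ∈ sourceLabel D v)
    obtain ⟨u, huv, huw⟩ := (h v w).1 ⟨s, hsv, hsw.2⟩
    exact (hv.eq_of_reflTransGen huv).symm.trans (hw.eq_of_reflTransGen huw)

end Labelings

section EdgeOperations

variable {ι : Type*} {m : V → Set ι} {D E : Digraph V}

theorem IsDAG.of_le (hE : IsDAG E) (h : ∀ a b, D.Adj a b → E.Adj a b) : IsDAG D :=
  fun v hv => hE v (TransGen.mono h v v hv)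

theorem transGen_addEdge {v w a b : V} (h : TransGen (addEdge D v w).Adj a b) :
    TransGen D.Adj a b ∨ ReflTransGen D.Adj a v ∧ ReflTransGen D.Adj w b := by
  induction h with
  | single h =>
    rcases h with h | ⟨rfl, rfl⟩
    · exact .inl (.single h)
    · exact .inr ⟨.refl, .refl⟩
  | tail _ h ih =>
    rcases h with h | ⟨rfl, rfl⟩
    · rcases ih with ih | ⟨ih, ih'⟩
      · exact .inl (ih.tail h)
      · exact .inr ⟨ih, ih'.tail h⟩
    · rcases ih with ih | ⟨ih, _⟩
      · exact .inr ⟨ih.to_reflTransGen, .refl⟩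
      · exact .inr ⟨ih, .refl⟩

theorem IsDAG.addEdge (hD : IsDAG D) {v w : V} (h : ¬ ReflTransGen D.Adj w v) :
    IsDAG (addEdge D v w) := fun a ha => by
  rcases transGen_addEdge ha with ha | ⟨hav, hwa⟩
  · exact hD a ha
  · exact h (hwa.trans hav)

theorem revEdge_eq_addEdge_delEdge (v w : V) : revEdge D v w = addEdge (delEdge D v w) w v := rfl

theorem IsDAG.revEdge (hD : IsDAG D) {v w : V} (hvw : D.Adj v w)
    (h : v ∉ anSet D (pa D w \ {v})) : IsDAG (revEdge D v w) := by
  rw [revEdge_eq_addEdge_delEdge]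
  have hle : ∀ a b, (delEdge D v w).Adj a b → D.Adj a b := fun _ _ h => h.1
  refine (hD.of_le hle).addEdge fun hp => ?_
  rcases hp.cases_tail with rfl | ⟨u, hvu, huw⟩
  · exact hD _ (.single hvw)
  · refine h (Set.mem_biUnion (x := u) ⟨huw.1, ?_⟩ (ReflTransGen.mono hle _ _ hvu))
    rintro rfl
    exact huw.2 ⟨rfl, rfl⟩

theorem adjacent_revEdge {v w : V} (hvw : D.Adj v w) (a b : V) :
    Adjacent (revEdge D v w) a b ↔ Adjacent D a b := by
  simp only [Adjacent, revEdge]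
  grind

theorem adjacent_comm {a b : V} : Adjacent D a b ↔ Adjacent D b a := or_comm

theorem IsCompatible.addEdge (hD : IsCompatible m D) {v w : V} (hm : m v ⊆ m w)
    (hw : ¬ IsSource D w) (hwv : ¬ ReflTransGen D.Adj w v) : IsCompatible m (addEdge D v w) := by
  have hs : ∀ x, IsSource (UEC.addEdge D v w) x → IsSource D x := fun x hx =>
    isSource_iff.2 fun u hu => isSource_iff.1 hx u (.inl hu)
  refine ⟨hD.isDAG.addEdge hwv, ?_, fun x hx s hsx => ?_, fun x hx => hD.source (hs x hx),
    fun x y hx hy => hD.inj (hs x hx) (hs y hy)⟩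
  · rintro a b (h | ⟨rfl, rfl⟩)
    · exact hD.mono h
    · exact hm
  · have hx' : ¬ IsSource D x := by
      obtain ⟨u, hu | ⟨rfl, rfl⟩⟩ := exists_adj_of_not_isSource hx
      · exact fun h => isSource_iff.1 h u hu
      · exact hw
    obtain ⟨u, hu, hsu⟩ := hD.cover hx' s hsx
    exact ⟨u, .inl hu, hsu⟩

/-- A reversal of a weakly covered edge that leads to a graph compatible with `m`. -/
def CompatibleReversal (m : V → Set ι) (E F : Digraph V) : Prop :=
  ReverseStep E F ∧ IsCompatible m F

theorem isSource_revEdge_of_ne {v w x : V} (hv : x ≠ v) (hw : x ≠ w) :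
    IsSource (revEdge D v w) x ↔ IsSource D x := by
  simp only [isSource_iff, revEdge]
  grind

theorem IsCompatible.reversal_source (hD : IsCompatible m D) {v w : V} (hvw : D.Adj v w)
    (hm : m w ⊆ m v) (hv : IsSource D v) (hw : pa D w = {v}) :
    CompatibleReversal m D (revEdge D v w) ∧
      ∀ x, IsSource (revEdge D v w) x ↔ IsSource D x ∧ x ≠ v ∨ x = w := by
  have hne : v ≠ w := by
    rintro rfl
    exact hD.isDAG v (.single hvw)
  have hmw : m w = m v := hm.antisymm (hD.mono hvw)
  have hw' : ∀ u, D.Adj u w → u = v := fun u hu => by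
    have : u ∈ pa D w := hu
    rwa [hw] at this
  have han : v ∉ anSet D (pa D w \ {v}) := by simp [hw, anSet]
  have hsrc : ∀ x, IsSource (revEdge D v w) x ↔ IsSource D x ∧ x ≠ v ∨ x = w := by
    intro x
    by_cases hxv : x = v
    · subst hxv
      exact iff_of_false (fun h => isSource_iff.1 h w (.inr ⟨rfl, rfl⟩)) (by simp [hne])
    by_cases hxw : x = w
    · subst hxw
      refine iff_of_true (isSource_iff.2 ?_) (.inr rfl)
      rintro u (h | h)
      · exact h.2 ⟨hw' u h.1, rfl⟩
      · exact hne h.2.symm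
    rw [isSource_revEdge_of_ne hxv hxw]
    simp [hxv, hxw]
  refine ⟨⟨⟨v, w, hvw, ⟨?_, han⟩, rfl⟩, hD.isDAG.revEdge hvw han, ?_, fun x hx s hs => ?_,
    fun x hx => ?_, fun x y hx hy hxy => ?_⟩, hsrc⟩
  · rw [show pa D v = ∅ from hv, hw, Set.sdiff_self]
  · rintro a b (h | ⟨rfl, rfl⟩)
    · exact hD.mono h.1
    · exact hm
  · by_cases hxv : x = v
    · subst hxv
      exact ⟨w, .inr ⟨rfl, rfl⟩, hmw ▸ hs⟩
    · have hxw : x ≠ w := fun h => hx ((hsrc x).2 (.inr h))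
      obtain ⟨u, hu, hsu⟩ := hD.cover (fun h => hx ((hsrc x).2 (.inl ⟨h, hxv⟩))) s hs
      exact ⟨u, .inl ⟨hu, fun hc => hxw hc.2⟩, hsu⟩
  · rcases (hsrc x).1 hx with ⟨hx, _⟩ | rfl
    · exact hD.source hx
    · rw [hmw]
      exact hD.source hv
  · rcases (hsrc x).1 hx with ⟨hx, hxv⟩ | hxw <;> rcases (hsrc y).1 hy with ⟨hy, hyv⟩ | hyw
    · exact hD.inj hx hy hxy
    · exact (hxv (hD.inj hx hv (by rw [hxy, hyw, hmw]))).elim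
    · exact (hyv (hD.inj hy hv (by rw [← hxy, hxw, hmw]))).elim
    · rw [hxw, hyw]

variable [Finite V]

theorem IsCompatible.exists_insertStep (hD : IsCompatible m D) (hE : IsCompatible m E) {v w : V}
    (hvw : E.Adj v w) (hn : ¬ Adjacent D v w) :
    ∃ F, InsertStep D F ∧ IsCompatible m F ∧
      ∀ a b, Adjacent F a b ↔ Adjacent D a b ∨ (a = v ∧ b = w) ∨ (a = w ∧ b = v) := by
  have hm := hE.mono hvw
  have hne : v ≠ w := by
    rintro rfl
    exact hE.isDAG v (.single hvw)
  have trans_case : ∀ {a b : V}, a ≠ b → ¬ Adjacent D a b → ReflTransGen D.Adj a b →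
      InsertStep D (UEC.addEdge D a b) ∧ IsCompatible m (UEC.addEdge D a b) := by
    intro a b hab hadj h
    have hab' : TransGen D.Adj a b := by
      rcases reflTransGen_iff_eq_or_transGen.1 h with h | h
      · exact (hab h.symm).elim
      · exact h
    refine ⟨⟨a, b, hab, hadj, .inr ⟨h, ?_⟩, rfl⟩, hD.addEdge (hD.mono_reflTransGen h) ?_ ?_⟩
    · rintro (h | h)
      · exact hab h
      · exact hadj (.inl h)
    · exact fun hs => hab (hs.eq_of_reflTransGen h)
    · exact fun h' => hD.isDAG a (hab'.trans_left h')
  by_cases h1 : ReflTransGen D.Adj v w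
  · obtain ⟨h2, h3⟩ := trans_case hne hn h1
    refine ⟨_, h2, h3, fun a b => ?_⟩
    simp only [Adjacent, UEC.addEdge]
    tauto
  by_cases h2 : ReflTransGen D.Adj w v
  · obtain ⟨h2, h3⟩ := trans_case hne.symm (by rwa [adjacent_comm]) h2
    refine ⟨_, h2, h3, fun a b => ?_⟩
    simp only [Adjacent, UEC.addEdge]
    tauto
  have hma : maSet D {v} ⊆ maSet D {w} :=
    hD.maSet_subset fun s a ha hs => ⟨w, rfl, hm (by rwa [← Set.mem_singleton_iff.1 ha])⟩
  refine ⟨UEC.addEdge D v w, ⟨v, w, hne, hn, .inl ⟨hma, h1, h2, fun hv => ?_⟩, rfl⟩,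
    hD.addEdge hm (fun hw => ?_) h2, fun a b => ?_⟩
  · have hmem := hma ((mem_maSet_iff hD.isDAG).2 ⟨hv, v, rfl, .refl⟩)
    obtain ⟨_, b, rfl, hb⟩ := (mem_maSet_iff hD.isDAG).1 hmem
    exact h1 hb
  · obtain ⟨s, hs⟩ := hD.nonempty v
    obtain ⟨u, hu, hsu, huv⟩ := hD.exists_source hs
    obtain rfl := hD.source_unique hu hw hsu (hm hs)
    exact h2 huv
  · simp only [Adjacent, UEC.addEdge]
    tauto

theorem IsCompatible.reversal (hD : IsCompatible m D) {v w : V} (hvw : D.Adj v w)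
    (hm : m w ⊆ m v) (han : v ∉ anSet D (pa D w \ {v})) (hv : ¬ IsSource D v)
    (hcov : ∀ s ∈ m w, ∃ u, u ≠ v ∧ D.Adj u w ∧ s ∈ m u) :
    CompatibleReversal m D (revEdge D v w) ∧
      ∀ x, IsSource (revEdge D v w) x ↔ IsSource D x := by
  have hm' := hD.mono hvw
  have hsrc : ∀ x, IsSource (revEdge D v w) x ↔ IsSource D x := by
    intro x
    by_cases hxv : x = v
    · subst hxv
      exact iff_of_false (fun h => isSource_iff.1 h w (.inr ⟨rfl, rfl⟩)) hv
    by_cases hxw : x = w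
    · subst hxw
      refine iff_of_false (fun h => ?_) fun h => isSource_iff.1 h v hvw
      obtain ⟨s, hs⟩ := hD.nonempty x
      obtain ⟨u, huv, hux, _⟩ := hcov s hs
      exact isSource_iff.1 h u (.inl ⟨hux, fun hc => huv hc.1⟩)
    exact isSource_revEdge_of_ne hxv hxw
  refine ⟨⟨⟨v, w, hvw, ⟨?_, han⟩, rfl⟩, hD.isDAG.revEdge hvw han, ?_, fun x hx s hs => ?_,
    fun x hx => hD.source ((hsrc x).1 hx),
    fun x y hx hy => hD.inj ((hsrc x).1 hx) ((hsrc y).1 hy)⟩, hsrc⟩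
  · apply subset_antisymm <;> apply hD.maSet_subset
    · intro s a ha hs
      obtain ⟨u, huv, huw, hsu⟩ := hcov s (hm' (hD.mono ha hs))
      exact ⟨u, ⟨huw, huv⟩, hsu⟩
    · intro s a ha hs
      exact hD.cover hv s (hm (hD.mono ha.1 hs))
  · rintro a b (h | ⟨rfl, rfl⟩)
    · exact hD.mono h.1
    · exact hm
  · by_cases hxw : x = w
    · subst hxw
      obtain ⟨u, huv, hux, hsu⟩ := hcov s hs
      exact ⟨u, .inl ⟨hux, fun hc => huv hc.1⟩, hsu⟩
    · obtain ⟨u, hu, hsu⟩ := hD.cover (fun h => hx ((hsrc x).2 h)) s hs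
      exact ⟨u, .inl ⟨hu, fun hc => hxw hc.2⟩, hsu⟩

end EdgeOperations

section Reversals

variable {ι : Type*} {m : V → Set ι} {G H : Digraph V}

/-- The pairs on whose orientation `G` and `H` disagree, oriented as in `G`. -/
def reversedPairs (G H : Digraph V) : Set (V × V) := {p | G.Adj p.1 p.2 ∧ H.Adj p.2 p.1}

theorem eq_of_reversedPairs_eq_empty (hadj : ∀ a b, Adjacent G a b ↔ Adjacent H a b) (h : reversedPairs G H = ∅) : G = H := by
  have h' : ∀ a b, G.Adj a b → ¬ H.Adj b a := fun a b hab hba => by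
    have : (a, b) ∈ reversedPairs G H := ⟨hab, hba⟩
    simp [h] at this
  ext a b
  constructor
  · exact fun hab => ((hadj a b).1 (.inl hab)).resolve_right (h' a b hab)
  · exact fun hab => ((hadj a b).2 (.inl hab)).resolve_right fun hba => h' b a hba hab

/-- Turn the edges between `x` and its parents other than `r` into edges out of `x`. -/
def raise (G : Digraph V) (r x : V) : Digraph V :=
  ⟨fun a b => (G.Adj a b ∧ (b = x → a = r)) ∨ (a = x ∧ G.Adj b x ∧ b ≠ r)⟩

theorem adjacent_raise (r x a b : V) : Adjacent (raise G r x) a b ↔ Adjacent G a b := by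
  simp only [Adjacent, raise]
  grind

theorem pa_raise (hG : IsDAG G) {r x : V} (hrx : G.Adj r x) : pa (raise G r x) x = {r} := by
  ext a
  constructor
  · rintro (h | ⟨_, h, _⟩)
    · exact h.2 rfl
    · exact (hG x (.single h)).elim
  · rintro rfl
    exact .inl ⟨hrx, fun _ => rfl⟩

variable [Finite V]

theorem IsCompatible.exists_reversal (hG : IsCompatible m G) (hH : IsCompatible m H)
    (hadj : ∀ a b, Adjacent G a b ↔ Adjacent H a b) (hsrc : ∀ v, IsSource G v ↔ IsSource H v)
    (hne : (reversedPairs G H).Nonempty) :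
    ∃ v w, (v, w) ∈ reversedPairs G H ∧ CompatibleReversal m G (revEdge G v w) ∧
      ∀ x, IsSource (revEdge G v w) x ↔ IsSource G x := by
  have keep : ∀ {a b}, G.Adj a b → ¬ H.Adj b a → H.Adj a b := fun {a b} h h' =>
    ((hadj a b).1 (.inl h)).resolve_right h'
  obtain ⟨v, ⟨w₀, hvw₀⟩, hmax⟩ := hG.isDAG.wellFounded_swap.has_min
    {v | ∃ w, (v, w) ∈ reversedPairs G H} (by
      obtain ⟨⟨a, b⟩, hab⟩ := hne
      exact ⟨a, b, hab⟩)
  obtain ⟨w, hvw, hmin⟩ := hG.isDAG.wellFounded.has_min {w | (v, w) ∈ reversedPairs G H} ⟨w₀, hvw₀⟩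
  have agree : ∀ {a b}, TransGen G.Adj v a → G.Adj a b → H.Adj a b := fun {a b} ha hab =>
    keep hab fun hba => hmax a ⟨b, hab, hba⟩ ha
  have hv : ¬ IsSource G v := fun h => isSource_iff.1 ((hsrc v).1 h) w hvw.2
  have hw : ¬ IsSource H w := fun h => isSource_iff.1 ((hsrc w).2 h) v hvw.1
  refine ⟨v, w, hvw, hG.reversal hvw.1 (hH.mono hvw.2) (fun han => ?_) hv fun s hs => ?_⟩
  · simp only [anSet, an, Set.mem_iUnion] at han
    obtain ⟨u, ⟨huw, huv⟩, hvu⟩ := han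
    rcases hvu.cases_head with rfl | ⟨z, hvz, hzu⟩
    · exact huv rfl
    have hzw : TransGen G.Adj z w := TransGen.tail' hzu huw
    have hvz' : H.Adj v z := keep hvz fun hzv => hmin z ⟨hvz, hzv⟩ hzw
    have hH' : ∀ x, ReflTransGen G.Adj z x → ReflTransGen H.Adj z x := by
      intro x hx
      induction hx with
      | refl => exact .refl
      | tail hzc hcd ih => exact ih.tail (agree (TransGen.head' hvz hzc) hcd)
    exact hH.isDAG w (TransGen.head hvw.2 (TransGen.head' hvz' (hH' w hzw.to_reflTransGen)))
  · obtain ⟨u, huw, hsu⟩ := hH.cover hw s hs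
    refine ⟨u, ?_, ?_, hsu⟩
    · rintro rfl
      exact hH.isDAG.asymm huw hvw.2
    · refine ((hadj u w).2 (.inl huw)).resolve_right fun hwu => ?_
      exact hH.isDAG.asymm huw (agree (.single hvw.1) hwu)

theorem IsCompatible.reflTransGen_of_isSource_iff (hG : IsCompatible m G) (hH : IsCompatible m H)
    (hadj : ∀ a b, Adjacent G a b ↔ Adjacent H a b) (hsrc : ∀ v, IsSource G v ↔ IsSource H v) :
    ReflTransGen (CompatibleReversal m) G H := by
  induction hn : (reversedPairs G H).ncard using Nat.strong_induction_on generalizing G with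
  | _ n ih =>
    rcases (reversedPairs G H).eq_empty_or_nonempty with hemp | hne
    · rw [eq_of_reversedPairs_eq_empty hadj hemp]
    · obtain ⟨v, w, hvw, hstep, hsrc'⟩ := hG.exists_reversal hH hadj hsrc hne
      refine .head hstep (ih _ ?_ hstep.2 (fun a b => ?_) (fun x => ?_) rfl)
      · rw [← hn]
        refine Set.ncard_lt_ncard ⟨?_, fun hle => ?_⟩ (Set.toFinite _)
        · rintro ⟨a, b⟩ ⟨hab | ⟨rfl, rfl⟩, hba⟩
          · exact ⟨hab.1, hba⟩
          · exact (hH.isDAG.asymm hba hvw.2).elim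
        · rcases (hle hvw).1 with h | ⟨h, _⟩
          · exact h.2 ⟨rfl, rfl⟩
          · have h : v = w := h
            subst h
            exact hG.isDAG v (.single hvw.1)
      · rw [adjacent_revEdge hvw.1, hadj]
      · rw [hsrc', hsrc]

theorem IsCompatible.isSource_raise (hG : IsCompatible m G) {r x : V} (hr : IsSource G r)
    (hrx : G.Adj r x) (hm : m x ⊆ m r) (v : V) : IsSource (raise G r x) v ↔ IsSource G v := by
  by_cases hvx : v = x
  · subst hvx
    refine iff_of_false (fun h => ?_) fun h => isSource_iff.1 h r hrx
    have := pa_raise hG.isDAG hrx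
    rw [show pa (raise G r v) v = ∅ from h] at this
    exact Set.singleton_ne_empty r this.symm
  constructor
  · refine fun h => isSource_iff.2 fun u hu => isSource_iff.1 h u (.inl ⟨hu, fun h => (hvx h).elim⟩)
  · refine fun h => isSource_iff.2 ?_
    rintro u (hu | ⟨rfl, hvu, hvr⟩)
    · exact isSource_iff.1 h u hu.1
    · obtain ⟨s, hs⟩ := hG.nonempty v
      exact hvr (hG.source_unique h hr hs (hm (hG.mono hvu hs)))

theorem IsCompatible.raise (hG : IsCompatible m G) {r x : V} (hr : IsSource G r)
    (hrx : G.Adj r x) (hm : m x ⊆ m r) : IsCompatible m (raise G r x) := by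
  have hsrc := hG.isSource_raise hr hrx hm
  have hpa : ∀ a, (UEC.raise G r x).Adj a x → a = r := fun a ha => by
    have : a ∈ pa (UEC.raise G r x) x := ha
    rwa [pa_raise hG.isDAG hrx] at this
  have hr' := (hsrc r).2 hr
  refine ⟨fun a ha => ?_, ?_, fun v hv s hs => ?_, fun v hv => hG.source ((hsrc v).1 hv),
    fun v w hv hw => hG.inj ((hsrc v).1 hv) ((hsrc w).1 hw)⟩
  · have hx : ¬ TransGen (UEC.raise G r x).Adj x x := fun h => by
      obtain ⟨c, hxc, hcx⟩ := TransGen.tail'_iff.1 h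
      obtain rfl := hpa c hcx
      obtain rfl := hr'.eq_of_reflTransGen hxc
      exact hG.isDAG x (.single hrx)
    have key : ∀ {a b}, TransGen (UEC.raise G r x).Adj a b → a ≠ x → a ≠ r →
        TransGen G.Adj a b := by
      intro a b h
      induction h using TransGen.head_induction_on with
      | single h =>
        intro hax _
        exact .single (h.resolve_right fun h => hax h.1).1
      | head h _ ih =>
        intro hax har
        obtain ⟨hac, hcx⟩ := h.resolve_right fun h => hax h.1
        refine .head hac (ih (fun hc => har (hcx hc)) ?_)
        rintro rfl
        exact isSource_iff.1 hr _ hac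
    by_cases hax : a = x
    · exact hx (hax ▸ ha)
    by_cases har : a = r
    · subst har
      obtain ⟨c, _, hc⟩ := TransGen.tail'_iff.1 ha
      exact isSource_iff.1 hr' c hc
    exact hG.isDAG a (key ha hax har)
  · rintro a b (h | ⟨rfl, hb, _⟩)
    · exact hG.mono h.1
    · obtain ⟨s, hs⟩ := hG.nonempty b
      have h1 := hG.eq_singleton hr (hm (hG.mono hb hs))
      intro t ht
      have ht' := hm ht
      rw [h1] at ht'
      obtain rfl : t = s := ht'
      exact hs
  · by_cases hvx : v = x
    · subst hvx
      exact ⟨r, .inl ⟨hrx, fun _ => rfl⟩, hm hs⟩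
    · obtain ⟨u, hu, hsu⟩ := hG.cover (fun h => hv ((hsrc v).2 h)) s hs
      exact ⟨u, .inl ⟨hu, fun h => (hvx h).elim⟩, hsu⟩

theorem IsCompatible.exists_move_source (hG : IsCompatible m G) {r x : V} (hr : IsSource G r)
    (hrx : G.Adj r x) (hm : m x ⊆ m r) :
    ∃ F, ReflTransGen (CompatibleReversal m) G F ∧ IsCompatible m F ∧
      (∀ a b, Adjacent F a b ↔ Adjacent G a b) ∧
      ∀ v, IsSource F v ↔ IsSource G v ∧ v ≠ r ∨ v = x := by
  have hc := hG.raise hr hrx hm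
  have hsrc := hG.isSource_raise hr hrx hm
  have hpa := pa_raise hG.isDAG hrx
  have hrx' : (UEC.raise G r x).Adj r x := .inl ⟨hrx, fun _ => rfl⟩
  obtain ⟨hstep, hsrc'⟩ := hc.reversal_source hrx' hm ((hsrc r).2 hr) hpa
  refine ⟨_, .tail (hG.reflTransGen_of_isSource_iff hc (fun a b => (adjacent_raise r x a b).symm)
    fun v => (hsrc v).symm) hstep, hstep.2, fun a b => ?_, fun v => ?_⟩
  · rw [adjacent_revEdge hrx', adjacent_raise]
  · rw [hsrc', hsrc]

theorem IsCompatible.reflTransGen_reversal (hG : IsCompatible m G) (hH : IsCompatible m H)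
    (hadj : ∀ a b, Adjacent G a b ↔ Adjacent H a b) :
    ReflTransGen (CompatibleReversal m) G H := by
  induction hn : (anSet H (sources G)).ncard using Nat.strong_induction_on generalizing G with
  | _ n ih =>
    by_cases hall : ∀ r, IsSource G r → IsSource H r
    · refine hG.reflTransGen_of_isSource_iff hH hadj fun v => ⟨hall v, fun hv => ?_⟩
      obtain ⟨s, hs⟩ := hH.nonempty v
      obtain ⟨u, hu, hsu, _⟩ := hG.exists_source hs
      exact hH.source_unique (hall u hu) hv hsu hs ▸ hu
    · push Not at hall
      obtain ⟨r, hr, hrH⟩ := hall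
      obtain ⟨x, hxr⟩ := exists_adj_of_not_isSource hrH
      have hrx : G.Adj r x :=
        ((hadj r x).2 (.inr hxr)).resolve_right (isSource_iff.1 hr x)
      obtain ⟨F, hGF, hF, hadjF, hsrcF⟩ := hG.exists_move_source hr hrx (hH.mono hxr)
      refine hGF.trans (ih _ ?_ hF (fun a b => (hadjF a b).trans (hadj a b)) rfl)
      rw [← hn]
      refine Set.ncard_lt_ncard ⟨fun u hu => ?_, fun hle => ?_⟩ (Set.toFinite _)
      · obtain ⟨v, hv, huv⟩ := Set.mem_iUnion₂.1 hu
        rcases (hsrcF v).1 hv with ⟨hv, _⟩ | rfl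
        · exact Set.mem_biUnion hv huv
        · exact Set.mem_biUnion (x := r) hr (ReflTransGen.tail huv hxr)
      · have hmem : r ∈ anSet H (sources G) := Set.mem_biUnion (x := r) hr .refl
        obtain ⟨v, hv, hrv⟩ := Set.mem_iUnion₂.1 (hle hmem)
        rcases (hsrcF v).1 hv with ⟨hv, hvr⟩ | rfl
        · obtain ⟨s, hs⟩ := hG.nonempty r
          exact hvr (hG.source_unique hv hr (hH.mono_reflTransGen hrv hs) hs)
        · exact hH.isDAG v (TransGen.head' hxr hrv)

end Reversals

section Sequences

variable {ι : Type*} {m : V → Set ι} {D E : Digraph V}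

theorem InsertStep.deleteStep (h : InsertStep D E) : DeleteStep E D := by
  obtain ⟨v, w, _, hadj, hcond, rfl⟩ := h
  refine ⟨v, w, .inr ⟨rfl, rfl⟩, ?_, hcond⟩
  ext a b
  simp only [delEdge, addEdge]
  constructor
  · intro h
    exact ⟨.inl h, by rintro ⟨rfl, rfl⟩; exact hadj (.inl h)⟩
  · rintro ⟨h | h, h'⟩
    · exact h
    · exact (h' h).elim

theorem exists_seq_of_reflTransGen {α : Type*} {R : α → α → Prop} {P : α → Prop} {a b : α}
    (h : ReflTransGen (fun x y => R x y ∧ P y) a b) (ha : P a) :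
    ∃ (n : ℕ) (f : ℕ → α), f 0 = a ∧ f n = b ∧ (∀ i ≤ n, P (f i)) ∧
      ∀ i < n, R (f i) (f (i + 1)) := by
  induction h with
  | refl => exact ⟨0, fun _ => a, rfl, rfl, fun _ _ => ha, by simp⟩
  | @tail b c _ hbc ih =>
    obtain ⟨n, f, h0, hn, hP, hR⟩ := ih
    refine ⟨n + 1, fun i => if i ≤ n then f i else c, by simp [h0], by simp, fun i _ => ?_,
      fun i hi => ?_⟩
    · dsimp only
      split_ifs with h
      · exact hP i h
      · exact hbc.2
    · rcases Nat.lt_succ_iff_lt_or_eq.1 hi with h | rfl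
      · simpa [h.le, Nat.succ_le_of_lt h] using hR i h
      · simpa [hn] using hbc.1

theorem IsCompatible.exists_insert_seq [Finite V] (hD : IsCompatible m D)
    (hE : IsCompatible m E) :
    ∃ f : ℕ → Digraph V, f 0 = D ∧
      (∀ i, IsCompatible m (f i)) ∧
      (∀ i < {p : V × V | E.Adj p.1 p.2 ∧ ¬ Adjacent D p.1 p.2}.ncard,
        InsertStep (f i) (f (i + 1))) ∧
      ∀ a b, Adjacent (f {p : V × V | E.Adj p.1 p.2 ∧ ¬ Adjacent D p.1 p.2}.ncard) a b ↔
        Adjacent D a b ∨ Adjacent E a b := by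
  induction hn : {p : V × V | E.Adj p.1 p.2 ∧ ¬ Adjacent D p.1 p.2}.ncard generalizing D with
  | zero =>
    have hemp := (Set.ncard_eq_zero (Set.toFinite _)).1 hn
    refine ⟨fun _ => D, rfl, fun _ => hD, by simp, fun a b => ⟨.inl, ?_⟩⟩
    have hsub : ∀ a b, E.Adj a b → Adjacent D a b := fun a b hab => by
      by_contra hc
      have : (a, b) ∈ {p : V × V | E.Adj p.1 p.2 ∧ ¬ Adjacent D p.1 p.2} := ⟨hab, hc⟩
      simp [hemp] at this
    rintro (h | h | h)
    · exact h
    · exact hsub a b h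
    · exact adjacent_comm.1 (hsub b a h)
  | succ n ih =>
    obtain ⟨⟨v, w⟩, hvw, hnadj⟩ : {p : V × V | E.Adj p.1 p.2 ∧ ¬ Adjacent D p.1 p.2}.Nonempty :=
      Set.nonempty_of_ncard_ne_zero (by omega)
    obtain ⟨F, hstep, hF, hadj⟩ := hD.exists_insertStep hE hvw hnadj
    have hset : {p : V × V | E.Adj p.1 p.2 ∧ ¬ Adjacent F p.1 p.2} =
        {p : V × V | E.Adj p.1 p.2 ∧ ¬ Adjacent D p.1 p.2} \ {(v, w)} := by
      ext ⟨a, b⟩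
      have hwv := hE.isDAG.asymm hvw
      simp only [Set.mem_sdiff, Set.mem_ofPred_eq, Set.mem_singleton_iff, Prod.mk.injEq, hadj]
      grind
    obtain ⟨f, h0, hc, hs, ha⟩ := ih hF (by
      rw [hset, Set.ncard_sdiff_singleton_of_mem (by exact ⟨hvw, hnadj⟩), hn, Nat.add_sub_cancel])
    refine ⟨fun i => Nat.casesOn i D f, rfl, ?_, ?_, fun a b => (ha a b).trans ?_⟩
    · rintro (_ | i)
      · exact hD
      · exact hc i
    · rintro (_ | i) hi
      · simpa [h0] using hstep
      · exact hs i (by omega)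
    · rw [hadj]
      simp only [Adjacent]
      grind

end Sequences

/-- **Transformational characterization.**  Any two
unconditionally equivalent DAGs `D`, `D'` are connected by a sequence of DAGs
in the same unconditional equivalence class, consisting of `k` edge insertions
(where `k` is the number of vertex pairs adjacent in `D'` but not in `D`, each
inserted edge being partially weakly covered or implied by transitivity before
the insertion), followed by some number `r` of reversals of weakly covered
edges, followed by `l` edge deletions (where `l` is the number of vertex pairs
adjacent in `D` but not in `D'`, each deleted edge being partially weakly
covered or implied by transitivity after the deletion). -/
theorem transformational_characterization [Fintype V] (D D' : Digraph V)
    (hD : IsDAG D) (hD' : IsDAG D') (h : UncondEquiv D D') :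
    ∃ (k r l : ℕ) (Ds : ℕ → Digraph V),
      Ds 0 = D ∧ Ds (k + r + l) = D' ∧
      k = Set.ncard {p : V × V | D'.Adj p.1 p.2 ∧ ¬ Adjacent D p.1 p.2} ∧
      l = Set.ncard {p : V × V | D.Adj p.1 p.2 ∧ ¬ Adjacent D' p.1 p.2} ∧
      (∀ i ≤ k + r + l, IsDAG (Ds i) ∧ UncondEquiv D (Ds i)) ∧
      (∀ i < k, InsertStep (Ds i) (Ds (i + 1))) ∧
      (∀ i : ℕ, k ≤ i → i < k + r → ReverseStep (Ds i) (Ds (i + 1))) ∧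
      (∀ i : ℕ, k + r ≤ i → i < k + r + l → DeleteStep (Ds i) (Ds (i + 1))) := by
  have hconf := h.confounded_iff hD hD'
  have hcD : IsCompatible (sourceLabel D) D := isCompatible_sourceLabel hD hD fun _ _ => Iff.rfl
  have hcD' : IsCompatible (sourceLabel D) D' := isCompatible_sourceLabel hD hD' hconf
  obtain ⟨f, f0, hf, hfs, hfa⟩ := hcD.exists_insert_seq hcD'
  obtain ⟨g, g0, hg, hgs, hga⟩ := hcD'.exists_insert_seq hcD
  set k := {p : V × V | D'.Adj p.1 p.2 ∧ ¬ Adjacent D p.1 p.2}.ncard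
  set l := {p : V × V | D.Adj p.1 p.2 ∧ ¬ Adjacent D' p.1 p.2}.ncard
  obtain ⟨r, q, q0, qr, hq, hqs⟩ := exists_seq_of_reflTransGen
    ((hf k).reflTransGen_reversal (hg l) fun a b => by rw [hfa, hga, or_comm]) (hf k)
  let Ds : ℕ → Digraph V := fun i =>
    if i ≤ k then f i else if i ≤ k + r then q (i - k) else g (k + r + l - i)
  have hDs1 : ∀ i ≤ k, Ds i = f i := fun i hi => by simp [Ds, hi]
  have hDs2 : ∀ i ≤ r, Ds (k + i) = q i := fun i hi => by
    rcases Nat.eq_zero_or_pos i with rfl | hpos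
    · simp [Ds, q0]
    · simp [Ds, hi, hpos.ne']
  have hDs3 : ∀ i ≤ l, Ds (k + r + i) = g (l - i) := fun i hi => by
    rcases Nat.eq_zero_or_pos i with rfl | hpos
    · simpa [qr] using hDs2 r le_rfl
    · have h1 : ¬ k + r + i ≤ k := by omega
      have h2 : ¬ k + r + i ≤ k + r := by omega
      have h3 : k + r + l - (k + r + i) = l - i := by omega
      simp only [Ds, h1, h2, if_false, h3]
  have hDs : ∀ i ≤ k + r + l, IsCompatible (sourceLabel D) (Ds i) := fun i _ => by
    simp only [Ds]
    split_ifs with h1 h2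
    · exact hf i
    · exact hq _ (by omega)
    · exact hg _
  refine ⟨k, r, l, Ds, by rw [hDs1 0 (Nat.zero_le _), f0], ?_, rfl, rfl,
    fun i hi => ⟨(hDs i hi).isDAG, hcD.uncondEquiv (hDs i hi)⟩, fun i hi => ?_, fun i h1 h2 => ?_,
    fun i h1 h2 => ?_⟩
  · rw [hDs3 l le_rfl, Nat.sub_self, g0]
  · rw [hDs1 i hi.le, hDs1 (i + 1) hi]
    exact hfs i hi
  · obtain ⟨j, rfl⟩ := Nat.exists_eq_add_of_le h1
    rw [hDs2 j (by omega), add_assoc, hDs2 (j + 1) (by omega)]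
    exact hqs j (by omega)
  · obtain ⟨j, rfl⟩ := Nat.exists_eq_add_of_le h1
    rw [hDs3 j (by omega), add_assoc, hDs3 (j + 1) (by omega)]
    have := (hgs (l - (j + 1)) (by omega)).deleteStep
    rwa [show l - (j + 1) + 1 = l - j by omega] at this

end UEC
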